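/- arXiv:2601.09917 — 5 statements merged into one kernel-verified Lean document; each statement's English description precedes it below -/
import Mathlib

section
/- Let x_A, x_B ∈ ℝ³ be positions of two spherical agents with radii r_A, r_B > 0, let τ > 0 be a finite time horizon, and let v_A^pref, v_B^pref ∈ ℝ³ be the agents' preferred velocities with v_AB^pref = v_A^pref − v_B^pref. Let n ∈ ℝ³ and w ∈ ℝ³ be such that the open half-space H = {v ∈ ℝ³ | ⟨v − (v_AB^pref + w), n⟩ > 0} is disjoint from VO_{AB}^τ. Suppose agent A adopts a velocity v_A^new with ⟨v_A^new − (v_A^pref + (1/2)·w), n⟩ > 0 (i.e., v_A^new ∈ ORCA_{AB}^τ) and agent B adopts a velocity v_B^new with ⟨v_B^new − (v_B^pref − (1/2)·w), −n⟩ > 0 (i.e., v_B^new ∈ ORCA_{BA}^τ), and both velocities are held constant during the horizon. Then v_A^new − v_B^new ∉ VO_{AB}^τ; consequently, for every t with 0 < t ≤ τ, ‖(x_A + t·v_A^new) − (x_B + t·v_B^new)‖ > r_A + r_B, i.e., the agents do not collide before τ. -/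
open RealInnerProductSpace

/-- The velocity obstacle of agent A with respect to agent B for time horizon τ. -/
noncomputable def velocityObstacle (xA xB : EuclideanSpace ℝ (Fin 3)) (rA rB τ : ℝ) :
    Set (EuclideanSpace ℝ (Fin 3)) :=
  {v | ∃ t : ℝ, 0 < t ∧ t ≤ τ ∧ ‖v - (1 / t) • (xB - xA)‖ ≤ (rA + rB) / t}

/-- Suppose the open half-space
`H = {v | ⟪v − (v_AB^pref + w), n⟫ > 0}` is disjoint from `VO_{AB}^τ`.
If agent A adopts `v_A^new ∈ ORCA_{AB}^τ` and agent B adopts `v_B^new ∈ ORCA_{BA}^τ`,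
both held constant during the horizon, then `v_A^new − v_B^new ∉ VO_{AB}^τ` and the
agents do not collide before τ. -/
theorem orca_no_collision
    (xA xB vAp vBp n w vAnew vBnew : EuclideanSpace ℝ (Fin 3)) (rA rB τ : ℝ)
    (hrA : 0 < rA) (hrB : 0 < rB) (hτ : 0 < τ)
    (hdisj : {v : EuclideanSpace ℝ (Fin 3) | ⟪v - ((vAp - vBp) + w), n⟫ > 0} ∩
      velocityObstacle xA xB rA rB τ = ∅)
    (hA : ⟪vAnew - (vAp + (1 / 2 : ℝ) • w), n⟫ > 0)
    (hB : ⟪vBnew - (vBp - (1 / 2 : ℝ) • w), -n⟫ > 0) :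
    vAnew - vBnew ∉ velocityObstacle xA xB rA rB τ ∧
      ∀ t : ℝ, 0 < t → t ≤ τ →
        ‖(xA + t • vAnew) - (xB + t • vBnew)‖ > rA + rB := by
  have h1 : vAnew - vBnew ∉ velocityObstacle xA xB rA rB τ := by
    intro hv
    have hmem : vAnew - vBnew ∈ {v : EuclideanSpace ℝ (Fin 3) | ⟪v - ((vAp - vBp) + w), n⟫ > 0} ∩
        velocityObstacle xA xB rA rB τ := by
      refine ⟨?_, hv⟩
      show ⟪vAnew - vBnew - ((vAp - vBp) + w), n⟫ > 0
      simp only [inner_sub_left, inner_add_left, inner_smul_left, inner_neg_right,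
        conj_trivial] at hA hB ⊢
      linarith
    rw [hdisj] at hmem
    exact hmem
  refine ⟨h1, fun t ht htτ => ?_⟩
  by_contra hcon
  apply h1
  refine ⟨t, ht, htτ, ?_⟩
  have he : vAnew - vBnew - (1 / t) • (xB - xA) =
      (1 / t) • ((xA + t • vAnew) - (xB + t • vBnew)) := by
    have h2 : ∀ v : EuclideanSpace ℝ (Fin 3), (1 / t) • (t • v) = v := fun v => by
      rw [smul_smul, one_div_mul_cancel ht.ne', one_smul]
    rw [smul_sub, smul_sub, smul_add, smul_add, h2, h2]
    abel
  rw [he, norm_smul, Real.norm_of_nonneg (by positivity), one_div, inv_mul_eq_div]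
  exact div_le_div_of_nonneg_right (not_lt.mp hcon) ht.le
end

section
/- Consider an agent A at position x_A ∈ ℝ³ with radius r_A > 0 and maximum speed v_A^max > 0, and m−1 agents B_1, …, B_{m−1} at positions x_{B_i} ∈ ℝ³ with radii r_{B_i} > 0, with a finite time horizon τ > 0. Let v_A^pref and v_{B_i}^pref be preferred velocities. For each i ∈ {1, …, m−1}, let n_i ∈ ℝ³ and w_i ∈ ℝ³ be such that the open half-space H_i = {v ∈ ℝ³ | ⟨v − ((v_A^pref − v_{B_i}^pref) + w_i), n_i⟩ > 0} is disjoint from VO_{AB_i}^τ (the velocity obstacle defined from x_A, x_{B_i}, r_A, r_{B_i}, τ). Define ORCA_{AB_i}^τ = {v | ⟨v − (v_A^pref + (1/2)·w_i), n_i⟩ > 0}, ORCA_{B_iA}^τ = {v | ⟨v − (v_{B_i}^pref − (1/2)·w_i), −n_i⟩ > 0}, and ORCA_A^τ = {v | ‖v‖ ≤ v_A^max} ∩ ⋂_{i=1}^{m−1} ORCA_{AB_i}^τ. If agent A chooses v_A^new ∈ ORCA_A^τ and each agent B_i chooses v_{B_i}^new ∈ ORCA_{B_iA}^τ, all velocities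 being constant for the horizon τ, then for every i ∈ {1, …, m−1} it holds that v_A^new − v_{B_i}^new ∉ VO_{AB_i}^τ, i.e., A collides with no agent B_i before τ. -/
open RealInnerProductSpace

/-- Multi-agent ORCA: agent A together with agents `B_1, …, B_{m−1}`.
For each `i`, the open half-space `H_i` is disjoint from `VO_{AB_i}^τ`. If A chooses
`v_A^new ∈ ORCA_A^τ = {v | ‖v‖ ≤ v_A^max} ∩ ⋂ᵢ ORCA_{AB_i}^τ` and each `B_i` chooses
`v_{B_i}^new ∈ ORCA_{B_iA}^τ`, all velocities constant for the horizon, then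
`v_A^new − v_{B_i}^new ∉ VO_{AB_i}^τ` for every `i`, i.e. A collides with no `B_i`
before τ. -/
theorem orca_multi_agent_no_collision
    (m : ℕ) (xA : EuclideanSpace ℝ (Fin 3)) (rA : ℝ) (hrA : 0 < rA)
    (vAmax : ℝ) (hvAmax : 0 < vAmax)
    (xB : Fin (m - 1) → EuclideanSpace ℝ (Fin 3))
    (rB : Fin (m - 1) → ℝ) (hrB : ∀ i, 0 < rB i)
    (τ : ℝ) (hτ : 0 < τ)
    (vAp : EuclideanSpace ℝ (Fin 3)) (vBp : Fin (m - 1) → EuclideanSpace ℝ (Fin 3))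
    (n w : Fin (m - 1) → EuclideanSpace ℝ (Fin 3))
    (hdisj : ∀ i, {v : EuclideanSpace ℝ (Fin 3) | ⟪v - ((vAp - vBp i) + w i), n i⟫ > 0} ∩
      velocityObstacle xA (xB i) rA (rB i) τ = ∅)
    (vAnew : EuclideanSpace ℝ (Fin 3)) (vBnew : Fin (m - 1) → EuclideanSpace ℝ (Fin 3))
    (hAnew : vAnew ∈ {v : EuclideanSpace ℝ (Fin 3) | ‖v‖ ≤ vAmax} ∩
      ⋂ i, {v : EuclideanSpace ℝ (Fin 3) | ⟪v - (vAp + (1 / 2 : ℝ) • w i), n i⟫ > 0})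
    (hBnew : ∀ i, ⟪vBnew i - (vBp i - (1 / 2 : ℝ) • w i), -(n i)⟫ > 0) :
    ∀ i, vAnew - vBnew i ∉ velocityObstacle xA (xB i) rA (rB i) τ := by
  intro i hi
  have hA : ⟪vAnew - (vAp + (1 / 2 : ℝ) • w i), n i⟫ > 0 := Set.mem_iInter.mp hAnew.2 i
  have hB := hBnew i
  have hmem : vAnew - vBnew i ∈
      {v : EuclideanSpace ℝ (Fin 3) | ⟪v - ((vAp - vBp i) + w i), n i⟫ > 0} ∩
      velocityObstacle xA (xB i) rA (rB i) τ := by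
    refine ⟨?_, hi⟩
    simp only [Set.mem_setOf_eq, inner_sub_left, inner_add_left, inner_neg_right,
      real_inner_smul_left] at hA hB ⊢
    linarith
  rw [hdisj i] at hmem
  exact hmem
end

section
/- Let x_A, x_B ∈ ℝ³ be positions of two spherical agents with radii r_A, r_B > 0 satisfying ‖x_A − x_B‖ > r_A + r_B, and let τ > 0 be a finite time horizon. Let ε_A = {z ∈ ℝ³ | ⟨z, P_A z⟩ ≤ 1} and ε_B = {z ∈ ℝ³ | ⟨z, P_B z⟩ ≤ 1} be uncertainty ellipsoids given by symmetric positive-definite matrices P_A and P_B. Suppose the agents' realized velocities are v_A = v_A^pref − ξ_A and v_B = v_B^pref − ξ_B with ξ_A ∈ ε_A, ξ_B ∈ ε_B, constant during the horizon, where v_A^pref, v_B^pref are the preferred velocities. If the translated Minkowski sum satisfies (ε_A + ε_B + (v_A^pref − v_B^pref)) ∩ VO_{AB}^τ = ∅, then v_A − v_B ∉ VO_{AB}^τ, and hence for every t with 0 ≤ t ≤ τ it holds that ‖(x_A + t·v_A) − (x_B + t·v_B)‖ > r_A + r_B, i.e., A and B do not collide before τ. -/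
open RealInnerProductSpace Pointwise

/-- The uncertainty ellipsoid `{z ∈ ℝ³ | ⟪z, P z⟫ ≤ 1}` associated to a matrix P. -/
noncomputable def uncertaintyEllipsoid (P : Matrix (Fin 3) (Fin 3) ℝ) :
    Set (EuclideanSpace ℝ (Fin 3)) :=
  {z | ⟪z, Matrix.toEuclideanLin P z⟫ ≤ 1}

/-- If the agents start out of collision, the realized velocities are
`v_A = v_A^pref − ξ_A`, `v_B = v_B^pref − ξ_B` with `ξ_A ∈ ε_A`, `ξ_B ∈ ε_B`, and the
translated Minkowski sum `ε_A + ε_B + (v_A^pref − v_B^pref)` is disjoint from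
`VO_{AB}^τ`, then `v_A − v_B ∉ VO_{AB}^τ` and the agents do not collide during `[0, τ]`. -/
theorem disjoint_translated_sum_implies_no_collision
    (xA xB : EuclideanSpace ℝ (Fin 3)) (rA rB τ : ℝ)
    (hrA : 0 < rA) (hrB : 0 < rB) (hτ : 0 < τ)
    (hsep : ‖xA - xB‖ > rA + rB)
    (PA PB : Matrix (Fin 3) (Fin 3) ℝ)
    (hPA : PA.PosDef) (hPB : PB.PosDef)
    (hPAsymm : PA.IsSymm) (hPBsymm : PB.IsSymm)
    (vAp vBp ξA ξB : EuclideanSpace ℝ (Fin 3))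
    (hξA : ξA ∈ uncertaintyEllipsoid PA) (hξB : ξB ∈ uncertaintyEllipsoid PB)
    (hdisj : (uncertaintyEllipsoid PA + uncertaintyEllipsoid PB +
        ({vAp - vBp} : Set (EuclideanSpace ℝ (Fin 3)))) ∩
      velocityObstacle xA xB rA rB τ = ∅) :
    (vAp - ξA) - (vBp - ξB) ∉ velocityObstacle xA xB rA rB τ ∧
      ∀ t : ℝ, 0 ≤ t → t ≤ τ →
        ‖(xA + t • (vAp - ξA)) - (xB + t • (vBp - ξB))‖ > rA + rB := by
  have key : (vAp - ξA) - (vBp - ξB) ∉ velocityObstacle xA xB rA rB τ := by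
    intro hmem
    have hneg : -ξA ∈ uncertaintyEllipsoid PA := by
      simpa [uncertaintyEllipsoid] using hξA
    have hin : (vAp - ξA) - (vBp - ξB) ∈ (uncertaintyEllipsoid PA + uncertaintyEllipsoid PB +
        ({vAp - vBp} : Set (EuclideanSpace ℝ (Fin 3)))) := by
      refine Set.mem_add.2 ⟨-ξA + ξB, Set.add_mem_add hneg hξB, vAp - vBp, rfl, ?_⟩
      abel
    have hboth := Set.mem_inter hin hmem
    rw [hdisj] at hboth
    exact hboth
  refine ⟨key, ?_⟩
  intro t ht0 htτ
  rcases ht0.eq_or_lt with h0 | hpos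
  · subst h0
    simpa using hsep
  · by_contra hle
    push Not at hle
    apply key
    refine ⟨t, hpos, htτ, ?_⟩
    rw [le_div_iff₀ hpos]
    have heq : (xA + t • (vAp - ξA)) - (xB + t • (vBp - ξB)) =
        t • ((vAp - ξA) - (vBp - ξB) - (1 / t) • (xB - xA)) := by
      rw [smul_sub t _ ((1 / t) • (xB - xA)), smul_smul, mul_one_div_cancel hpos.ne', one_smul,
        smul_sub t (vAp - ξA)]
      abel
    rw [heq, norm_smul, Real.norm_of_nonneg ht0, mul_comm] at hle
    exact hle
end

section
/- Let x_A, x_B ∈ ℝ³ be positions of two spherical agents with radii r_A, r_B > 0, let τ > 0 be a finite time horizon, and let v_A^pref, v_B^pref ∈ ℝ³ be preferred velocities with v_AB^pref = v_A^pref − v_B^pref. Let ε_A = {z ∈ ℝ³ | ⟨z, P_A z⟩ ≤ 1} and ε_B = {z ∈ ℝ³ | ⟨z, P_B z⟩ ≤ 1} be uncertainty ellipsoids given by symmetric positive-definite matrices P_A and P_B. Let p ∈ ℝ³ and let n ∈ ℝ³ be a unit vector such that the open half-space π = {v ∈ ℝ³ | ⟨v − p, n⟩ > 0} is disjoint from VO_{AB}^τ,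 and let w ∈ ℝ³ be such that ε_A + ε_B + v_AB^pref + w ⊆ π. Suppose agent A adopts v_A^new with ⟨v_A^new − (v_A^pref + (1/2)·w), n⟩ > 0 and agent B adopts v_B^new with ⟨v_B^new − (v_B^pref − (1/2)·w), −n⟩ > 0, and due to disturbance-measurement uncertainty the realized velocities are v_A = v_A^new − ξ_A and v_B = v_B^new − ξ_B with ξ_A ∈ ε_A, ξ_B ∈ ε_B, constant during the horizon. Then v_A − v_B ∈ π and hence v_A − v_B ∉ VO_{AB}^τ; consequently A and B do not collide before τ. -/
open RealInnerProductSpace Pointwise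

/-- Uncertainty-aware ORCA for two agents. The open half-space
`π = {v | ⟪v − p, n⟫ > 0}` is disjoint from `VO_{AB}^τ` and `w` translates the set
`ε_A + ε_B + v_AB^pref` into `π`. If `v_A^new ∈ ORCA_{AB}^τ`, `v_B^new ∈ ORCA_{BA}^τ`,
and the realized velocities are `v_A = v_A^new − ξ_A`, `v_B = v_B^new − ξ_B` with
`ξ_A ∈ ε_A`, `ξ_B ∈ ε_B`, then `v_A − v_B ∈ π`, hence `v_A − v_B ∉ VO_{AB}^τ` and
the agents do not collide before τ. -/
theorem orca_with_uncertainty_no_collision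
    (xA xB : EuclideanSpace ℝ (Fin 3)) (rA rB τ : ℝ)
    (hrA : 0 < rA) (hrB : 0 < rB) (hτ : 0 < τ)
    (vAp vBp p n w vAnew vBnew ξA ξB : EuclideanSpace ℝ (Fin 3))
    (hn : ‖n‖ = 1)
    (PA PB : Matrix (Fin 3) (Fin 3) ℝ)
    (hPA : PA.PosDef) (hPB : PB.PosDef)
    (hPAsymm : PA.IsSymm) (hPBsymm : PB.IsSymm)
    (hξA : ξA ∈ uncertaintyEllipsoid PA) (hξB : ξB ∈ uncertaintyEllipsoid PB)
    (hdisj : {v : EuclideanSpace ℝ (Fin 3) | ⟪v - p, n⟫ > 0} ∩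
      velocityObstacle xA xB rA rB τ = ∅)
    (hsub : uncertaintyEllipsoid PA + uncertaintyEllipsoid PB +
        ({vAp - vBp} : Set (EuclideanSpace ℝ (Fin 3))) +
        ({w} : Set (EuclideanSpace ℝ (Fin 3))) ⊆
      {v : EuclideanSpace ℝ (Fin 3) | ⟪v - p, n⟫ > 0})
    (hA : ⟪vAnew - (vAp + (1 / 2 : ℝ) • w), n⟫ > 0)
    (hB : ⟪vBnew - (vBp - (1 / 2 : ℝ) • w), -n⟫ > 0) :
    ((vAnew - ξA) - (vBnew - ξB)) ∈
        {v : EuclideanSpace ℝ (Fin 3) | ⟪v - p, n⟫ > 0} ∧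
      (vAnew - ξA) - (vBnew - ξB) ∉ velocityObstacle xA xB rA rB τ ∧
      ∀ t : ℝ, 0 < t → t ≤ τ →
        ‖(xA + t • (vAnew - ξA)) - (xB + t • (vBnew - ξB))‖ > rA + rB := by
  have hneg : -ξA ∈ uncertaintyEllipsoid PA := by
    simpa [uncertaintyEllipsoid] using hξA
  have hmem := hsub (Set.add_mem_add (Set.add_mem_add (Set.add_mem_add hneg hξB)
    (Set.mem_singleton (vAp - vBp))) (Set.mem_singleton w))
  have h1 : ((vAnew - ξA) - (vBnew - ξB)) ∈
      {v : EuclideanSpace ℝ (Fin 3) | ⟪v - p, n⟫ > 0} := by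
    simp only [Set.mem_setOf_eq] at hmem ⊢
    simp only [inner_sub_left, inner_add_left, inner_neg_left, inner_neg_right,
      real_inner_smul_left] at hmem hA hB ⊢
    linarith
  have h2 : (vAnew - ξA) - (vBnew - ξB) ∉ velocityObstacle xA xB rA rB τ := by
    intro h
    have h3 := Set.mem_inter h1 h
    rw [hdisj] at h3
    exact h3
  refine ⟨h1, h2, ?_⟩
  intro t ht htτ
  by_contra hcon
  apply h2
  refine ⟨t, ht, htτ, ?_⟩
  rw [le_div_iff₀ ht]
  have heq : (xA + t • (vAnew - ξA)) - (xB + t • (vBnew - ξB)) =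
      t • (((vAnew - ξA) - (vBnew - ξB)) - (1 / t) • (xB - xA)) := by
    rw [smul_sub t _ ((1 / t) • (xB - xA)), smul_smul, mul_one_div_cancel ht.ne', one_smul,
      smul_sub t (vAnew - ξA)]
    abel
  rw [heq, norm_smul, Real.norm_of_nonneg ht.le] at hcon
  linarith
end

section
/- Consider an agent A at position x_A ∈ ℝ³ with radius r_A > 0 and maximum speed v_A^max > 0, and m−1 agents B_1, …, B_{m−1} at positions x_{B_i} ∈ ℝ³ with radii r_{B_i} > 0, with a finite time horizon τ > 0 and preferred velocities v_A^pref, v_{B_i}^pref ∈ ℝ³. Let ε_A and ε_{B_i} (i = 1, …, m−1) be uncertainty ellipsoids, each of the form {z ∈ ℝ³ | ⟨z, P z⟩ ≤ 1} for a symmetric positive-definite matrix P. For each i, let p_i ∈ ℝ³ and a unit vector n_i ∈ ℝ³ be such that the open half-space π_i = {v | ⟨v − p_i, n_i⟩ > 0} is disjoint from VO_{AB_i}^τ (defined from x_A, x_{B_i}, r_A, r_{B_i}, τ), and let w_i ∈ ℝ³ satisfy ε_A + ε_{B_i} + (v_A^pref − v_{B_i}^pref) + w_i ⊆ π_i. Define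 ORCA_{AB_i}^τ = {v | ⟨v − (v_A^pref + (1/2)·w_i), n_i⟩ > 0}, ORCA_{B_iA}^τ = {v | ⟨v − (v_{B_i}^pref − (1/2)·w_i), −n_i⟩ > 0}, and ORCA_A^τ = {v | ‖v‖ ≤ v_A^max} ∩ ⋂_{i=1}^{m−1} ORCA_{AB_i}^τ. Suppose agent A chooses v_A^new ∈ ORCA_A^τ and each B_i chooses v_{B_i}^new ∈ ORCA_{B_iA}^τ, and the realized velocities are v_A = v_A^new − ξ_A and v_{B_i} = v_{B_i}^new − ξ_{B_i} with ξ_A ∈ ε_A and ξ_{B_i} ∈ ε_{B_i}, all constant during the horizon. Then for every i ∈ {1, …, m−1} it holds that v_A − v_{B_i} ∉ VO_{AB_i}^τ, i.e., A collides with no agent B_i before τ. -/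
open RealInnerProductSpace Pointwise

/-- Uncertainty-aware multi-agent ORCA: agent A with maximum speed
`v_A^max` together with agents `B_1, …, B_{m−1}`. For each `i`, the open half-space
`π_i = {v | ⟪v − p_i, n_i⟫ > 0}` is disjoint from `VO_{AB_i}^τ` and `w_i` translates
`ε_A + ε_{B_i} + (v_A^pref − v_{B_i}^pref)` into `π_i`. If A chooses
`v_A^new ∈ ORCA_A^τ = {v | ‖v‖ ≤ v_A^max} ∩ ⋂ᵢ ORCA_{AB_i}^τ`, each `B_i` chooses
`v_{B_i}^new ∈ ORCA_{B_iA}^τ`, and the realized velocities are `v_A = v_A^new − ξ_A`,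
`v_{B_i} = v_{B_i}^new − ξ_{B_i}` with `ξ_A ∈ ε_A`, `ξ_{B_i} ∈ ε_{B_i}`, then
`v_A − v_{B_i} ∉ VO_{AB_i}^τ` for every `i`, i.e. A collides with no `B_i` before τ. -/
theorem orca_multi_agent_with_uncertainty_no_collision
    (m : ℕ) (xA : EuclideanSpace ℝ (Fin 3)) (rA : ℝ) (hrA : 0 < rA)
    (vAmax : ℝ) (hvAmax : 0 < vAmax)
    (xB : Fin (m - 1) → EuclideanSpace ℝ (Fin 3))
    (rB : Fin (m - 1) → ℝ) (hrB : ∀ i, 0 < rB i)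
    (τ : ℝ) (hτ : 0 < τ)
    (vAp : EuclideanSpace ℝ (Fin 3)) (vBp : Fin (m - 1) → EuclideanSpace ℝ (Fin 3))
    (PA : Matrix (Fin 3) (Fin 3) ℝ) (hPA : PA.PosDef) (hPAsymm : PA.IsSymm)
    (PB : Fin (m - 1) → Matrix (Fin 3) (Fin 3) ℝ)
    (hPB : ∀ i, (PB i).PosDef) (hPBsymm : ∀ i, (PB i).IsSymm)
    (p n w : Fin (m - 1) → EuclideanSpace ℝ (Fin 3)) (hn : ∀ i, ‖n i‖ = 1)
    (hdisj : ∀ i, {v : EuclideanSpace ℝ (Fin 3) | ⟪v - p i, n i⟫ > 0} ∩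
      velocityObstacle xA (xB i) rA (rB i) τ = ∅)
    (hsub : ∀ i, uncertaintyEllipsoid PA + uncertaintyEllipsoid (PB i) +
        ({vAp - vBp i} : Set (EuclideanSpace ℝ (Fin 3))) +
        ({w i} : Set (EuclideanSpace ℝ (Fin 3))) ⊆
      {v : EuclideanSpace ℝ (Fin 3) | ⟪v - p i, n i⟫ > 0})
    (vAnew : EuclideanSpace ℝ (Fin 3)) (vBnew : Fin (m - 1) → EuclideanSpace ℝ (Fin 3))
    (hAnew : vAnew ∈ {v : EuclideanSpace ℝ (Fin 3) | ‖v‖ ≤ vAmax} ∩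
      ⋂ i, {v : EuclideanSpace ℝ (Fin 3) | ⟪v - (vAp + (1 / 2 : ℝ) • w i), n i⟫ > 0})
    (hBnew : ∀ i, ⟪vBnew i - (vBp i - (1 / 2 : ℝ) • w i), -(n i)⟫ > 0)
    (ξA : EuclideanSpace ℝ (Fin 3)) (hξA : ξA ∈ uncertaintyEllipsoid PA)
    (ξB : Fin (m - 1) → EuclideanSpace ℝ (Fin 3))
    (hξB : ∀ i, ξB i ∈ uncertaintyEllipsoid (PB i)) :
    ∀ i, (vAnew - ξA) - (vBnew i - ξB i) ∉ velocityObstacle xA (xB i) rA (rB i) τ := by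
  intro i hvo
  have hneg : -ξA ∈ uncertaintyEllipsoid PA := by
    simpa [uncertaintyEllipsoid] using hξA
  have h1 := hsub i (Set.add_mem_add (Set.add_mem_add (Set.add_mem_add hneg (hξB i))
    (Set.mem_singleton _)) (Set.mem_singleton _))
  have h2 := Set.mem_iInter.1 hAnew.2 i
  have h3 := hBnew i
  have h4 : (vAnew - ξA) - (vBnew i - ξB i) ∈
      {v : EuclideanSpace ℝ (Fin 3) | ⟪v - p i, n i⟫ > 0} ∩
        velocityObstacle xA (xB i) rA (rB i) τ := by
    refine ⟨?_, hvo⟩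
    simp only [Set.mem_setOf_eq, inner_sub_left, inner_add_left, inner_neg_left,
      inner_neg_right, real_inner_smul_left] at h1 h2 h3 ⊢
    linarith
  rw [hdisj i] at h4
  exact h4
end
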